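/- For every r > 0, a homogeneous Poisson point process ξ on ℝ^d is almost surely (r,ρ)-robust for some ρ ∈ (0,1): (1) whenever x, y ∈ ξ ∩ B(0,r) have Voronoi cells intersecting in B(0,2r), there is a witness w ∈ B(0,2r) with |w-x| = |w-y| < d(w, ξ \ {x,y}) - ρr; (2) whenever the cells of x, y ∈ ξ ∩ B(0,r) are disjoint, max{|w-x|, |w-y|} > d(w, ξ) + ρr for all w ∈ B(0,2r). -/

import Mathlib

open MeasureTheory

/-- `η` is a Poisson point process on `E` with intensity measure `μ` under `P`. -/
def IsPoissonPP {E Ω : Type*} [MeasurableSpace E] [MeasurableSpace Ω]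
    (P : Measure Ω) (η : Ω → Set E) (μ : Measure E) : Prop :=
  (∀ A : Set E, MeasurableSet A → μ A ≠ ⊤ → ∀ k : ℕ,
    P {ω | (η ω ∩ A).ncard = k} =
      ENNReal.ofReal (Real.exp (-(μ A).toReal) * (μ A).toReal ^ k / (Nat.factorial k))) ∧
  (∀ (n : ℕ) (A : Fin n → Set E), (∀ i, MeasurableSet (A i)) →
    Pairwise (Function.onFun Disjoint A) → ∀ k : Fin n → ℕ,
      P {ω | ∀ i, (η ω ∩ A i).ncard = k i} = ∏ i, P {ω | (η ω ∩ A i).ncard = k i})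

/-- The Voronoi cell of `x` in the point configuration `X`. -/
def vorCell {E : Type*} [MetricSpace E] (x : E) (X : Set E) : Set E :=
  {z | dist z x ≤ Metric.infDist z X}

/-- `X` is `(r,ρ)`-robust: (1) whenever the Voronoi cells of distinct `x, y ∈ X ∩ B(0,r)`
intersect in `B(0,2r)`, there is a witness `w ∈ B(0,2r)` with
`|w-x| = |w-y| < d(w, X \ {x,y}) - ρ r`; (2) whenever the cells of distinct
`x, y ∈ X ∩ B(0,r)` are disjoint, `max(|w-x|, |w-y|) > d(w, X) + ρ r`
for all `w ∈ B(0,2r)`. -/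
def IsRobust {d : ℕ} (X : Set (EuclideanSpace ℝ (Fin d))) (r ρ : ℝ) : Prop :=
  ∀ x ∈ X ∩ Metric.ball (0 : EuclideanSpace ℝ (Fin d)) r,
  ∀ y ∈ X ∩ Metric.ball (0 : EuclideanSpace ℝ (Fin d)) r, x ≠ y →
    ((∃ z ∈ Metric.ball (0 : EuclideanSpace ℝ (Fin d)) (2 * r),
        z ∈ vorCell x X ∩ vorCell y X) →
      ∃ w ∈ Metric.ball (0 : EuclideanSpace ℝ (Fin d)) (2 * r),
        dist w x = dist w y ∧ dist w y < Metric.infDist w (X \ {x, y}) - ρ * r) ∧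
    (vorCell x X ∩ vorCell y X = ∅ →
      ∀ w ∈ Metric.ball (0 : EuclideanSpace ℝ (Fin d)) (2 * r),
        Metric.infDist w X + ρ * r < max (dist w x) (dist w y))

open Set Filter Topology

section Poisson

variable {E Ω : Type*} [MeasurableSpace E] [MeasurableSpace Ω] {P : Measure Ω}
  {ξ : Ω → Set E} {μ : Measure E}

lemma IsPoissonPP.measure_ncard_eq (h : IsPoissonPP P ξ μ) {A : Set E} (hA : MeasurableSet A)
    (hμ : μ A ≠ ⊤) (k : ℕ) :
    P {ω | (ξ ω ∩ A).ncard = k} = ProbabilityTheory.poissonMeasure (μ A).toNNReal {k} := by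
  rw [h.1 A hA hμ k, ProbabilityTheory.poissonMeasure_singleton]
  rfl

/-- An event on which the counts of sets of arbitrarily large measure vanish is null. -/
lemma IsPoissonPP.measure_eq_zero_of_void (h : IsPoissonPP P ξ μ) {S : Set Ω}
    (hS : ∀ n : ℕ, ∃ A, MeasurableSet A ∧ μ A ≠ ⊤ ∧ (n : ENNReal) ≤ μ A ∧
      S ⊆ {ω | (ξ ω ∩ A).ncard = 0}) : P S = 0 := by
  have key : ∀ n : ℕ, P S ≤ ENNReal.ofReal (Real.exp (-(n : ℝ))) := by
    intro n
    obtain ⟨A, hA, hA', hn, hSA⟩ := hS n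
    refine (measure_mono hSA).trans ?_
    rw [h.1 A hA hA' 0]
    apply ENNReal.ofReal_le_ofReal
    have : (n : ℝ) ≤ (μ A).toReal := by
      simpa using ENNReal.toReal_mono hA' hn
    simpa using this
  have hlim : Tendsto (fun n : ℕ ↦ ENNReal.ofReal (Real.exp (-(n : ℝ)))) atTop (𝓝 0) := by
    rw [← ENNReal.ofReal_zero]
    exact ENNReal.tendsto_ofReal
      (Real.tendsto_exp_neg_atTop_nhds_zero.comp tendsto_natCast_atTop_atTop)
  exact le_antisymm (ge_of_tendsto' hlim key) zero_le

lemma tendsto_measure_spanningSets [SigmaFinite μ] (hμ : μ univ = ⊤) :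
    Tendsto (fun k ↦ μ (spanningSets μ k)) atTop (𝓝 ⊤) := by
  rw [← hμ, ← iUnion_spanningSets μ]
  exact tendsto_measure_iUnion_atTop (monotone_spanningSets μ)

lemma IsPoissonPP.ae_finite_inter (h : IsPoissonPP P ξ μ) {A : Set E} (hA : MeasurableSet A)
    (hμA : μ A ≠ ⊤) [SigmaFinite μ] (hμ : μ univ = ⊤) :
    ∀ᵐ ω ∂P, (ξ ω ∩ A).Finite := by
  rw [ae_iff]
  refine h.measure_eq_zero_of_void fun n ↦ ?_
  obtain ⟨k, hk⟩ := ((tendsto_measure_spanningSets hμ).eventually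
    (lt_mem_nhds (ENNReal.natCast_lt_top n))).exists
  refine ⟨A ∪ spanningSets μ k, hA.union (measurableSet_spanningSets μ k),
    ((measure_union_le _ _).trans_lt
      (ENNReal.add_lt_top.2 ⟨hμA.lt_top, measure_spanningSets_lt_top μ k⟩)).ne,
    hk.le.trans (measure_mono subset_union_right), fun ω hω ↦ ?_⟩
  exact Set.Infinite.ncard fun hf ↦ hω (hf.subset (inter_subset_inter_right _ subset_union_left))

lemma IsPoissonPP.ae_exists_notMem [SigmaFinite μ] (h : IsPoissonPP P ξ μ)
    (hμ : μ univ = ⊤) {A : Set E} (hA : MeasurableSet A) (hμA : μ A ≠ ⊤) :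
    ∀ᵐ ω ∂P, ∃ p ∈ ξ ω, p ∉ A := by
  rw [ae_iff]
  refine h.measure_eq_zero_of_void fun n ↦ ?_
  obtain ⟨k, hk⟩ := ((tendsto_measure_spanningSets hμ).eventually (lt_mem_nhds
    (ENNReal.add_lt_top.2 ⟨ENNReal.natCast_lt_top n, hμA.lt_top⟩))).exists
  refine ⟨spanningSets μ k \ A, (measurableSet_spanningSets μ k).diff hA,
    measure_ne_top_of_subset sdiff_subset (measure_spanningSets_lt_top μ k).ne,
    (ENNReal.le_sub_of_add_le_right hμA hk.le).trans le_measure_sdiff, fun ω hω ↦ ?_⟩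
  have hempty : ξ ω ∩ (spanningSets μ k \ A) = ∅ :=
    eq_empty_of_forall_notMem fun p hp ↦ hω ⟨p, hp.1, hp.2.2⟩
  simp [hempty]

lemma poissonMeasure_Ioi_zero_le (m : NNReal) :
    ProbabilityTheory.poissonMeasure m (Ioi 0) ≤ m := by
  have : (Ioi 0 : Set ℕ) = {0}ᶜ := by ext; simp [Nat.pos_iff_ne_zero]
  rw [this, prob_compl_eq_one_sub (measurableSet_singleton 0),
    ProbabilityTheory.poissonMeasure_singleton, ← ENNReal.ofReal_one,
    ← ENNReal.ofReal_sub _ (by positivity), ← ENNReal.ofReal_coe_nnreal]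
  apply ENNReal.ofReal_le_ofReal
  have := Real.add_one_le_exp (-(m : ℝ))
  simp
  linarith

lemma IsPoissonPP.measure_forall_nonempty_le (h : IsPoissonPP P ξ μ) [SigmaFinite μ]
    (hμ : μ univ = ⊤) {n : ℕ} {A : Fin n → Set E} (hA : ∀ i, MeasurableSet (A i))
    (hdisj : Pairwise (Function.onFun Disjoint A)) (hμA : ∀ i, μ (A i) ≠ ⊤) :
    P {ω | ∀ i, (ξ ω ∩ A i).Nonempty} ≤ ∏ i, μ (A i) := by
  let ν : Fin n → Measure ℕ := fun i ↦ ProbabilityTheory.poissonMeasure (μ (A i)).toNNReal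
  let K : Set (Fin n → ℕ) := univ.pi fun _ ↦ Ioi 0
  have hfin : ∀ᵐ ω ∂P, ∀ i, (ξ ω ∩ A i).Finite :=
    ae_all_iff.2 fun i ↦ h.ae_finite_inter (hA i) (hμA i) hμ
  calc P {ω | ∀ i, (ξ ω ∩ A i).Nonempty}
      ≤ P (⋃ k : K, {ω | ∀ i, (ξ ω ∩ A i).ncard = k.1 i}) := by
        refine measure_mono_ae ?_
        filter_upwards [hfin] with ω hω hne
        exact mem_iUnion.2 ⟨⟨fun i ↦ (ξ ω ∩ A i).ncard, fun i _ ↦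
          (Set.ncard_pos (hω i)).2 (hne i)⟩, fun i ↦ rfl⟩
    _ ≤ ∑' k : K, P {ω | ∀ i, (ξ ω ∩ A i).ncard = k.1 i} := measure_iUnion_le _
    _ = ∑' k : K, Measure.pi ν {k.1} := by
        congr 1 with k
        rw [h.2 n A hA hdisj, Measure.pi_singleton]
        exact Finset.prod_congr rfl fun i _ ↦ h.measure_ncard_eq (hA i) (hμA i) _
    _ = Measure.pi ν K := by
        rw [← measure_biUnion K.to_countable (f := fun k ↦ {k})
          (fun a _ b _ hab ↦ disjoint_singleton.2 hab) (fun _ _ ↦ measurableSet_singleton _),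
          biUnion_of_singleton]
    _ = ∏ i, ν i (Ioi 0) := Measure.pi_pi _ _
    _ ≤ ∏ i, μ (A i) := Finset.prod_le_prod' fun i _ ↦
        (poissonMeasure_Ioi_zero_le _).trans (ENNReal.coe_toNNReal (hμA i)).le

/-- The outer measure sending a set `S` of `n`-tuples to the probability that `S` contains a tuple
of points of `ξ` with `i`-th point in `U i`. -/
def hittingOuterMeasure (P : Measure Ω) (ξ : Ω → Set E) {n : ℕ} (U : Fin n → Set E) :
    OuterMeasure (Fin n → E) where
  measureOf S := P {ω | ∃ x ∈ S, ∀ i, x i ∈ ξ ω ∩ U i}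
  empty := by simp
  mono hST := measure_mono fun ω ⟨x, hx, h⟩ ↦ ⟨x, hST hx, h⟩
  iUnion_nat s _ := by
    refine (measure_mono ?_).trans (measure_iUnion_le _)
    rintro ω ⟨x, hx, h⟩
    obtain ⟨i, hi⟩ := mem_iUnion.1 hx
    exact mem_iUnion.2 ⟨i, x, hi, h⟩

lemma IsPoissonPP.hittingOuterMeasure_le (h : IsPoissonPP P ξ μ) [SigmaFinite μ]
    (hμ : μ univ = ⊤) {n : ℕ} {U : Fin n → Set E} (hU : ∀ i, MeasurableSet (U i))
    (hdisj : Pairwise (Function.onFun Disjoint U)) (hμU : ∀ i, μ (U i) ≠ ⊤) :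
    hittingOuterMeasure P ξ U ≤ OuterMeasure.pi fun _ ↦ μ.toOuterMeasure := by
  rw [OuterMeasure.le_pi]
  intro s _
  let A : Fin n → Set E := fun i ↦ toMeasurable μ (s i) ∩ U i
  have hle := h.measure_forall_nonempty_le hμ (A := A)
    (fun i ↦ (measurableSet_toMeasurable _ _).inter (hU i))
    (fun i j hij ↦ (hdisj hij).mono inter_subset_right inter_subset_right)
    (fun i ↦ measure_ne_top_of_subset inter_subset_right (hμU i))
  calc P {ω | ∃ x ∈ univ.pi s, ∀ i, x i ∈ ξ ω ∩ U i}
      ≤ P {ω | ∀ i, (ξ ω ∩ A i).Nonempty} := measure_mono ?_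
    _ ≤ ∏ i, μ (A i) := hle
    _ ≤ ∏ i, μ (s i) := Finset.prod_le_prod' fun i _ ↦ ?_
  · rintro ω ⟨x, hx, hxU⟩ i
    exact ⟨x i, (hxU i).1, subset_toMeasurable μ _ (hx i (mem_univ i)), (hxU i).2⟩
  · exact (measure_mono inter_subset_left).trans (measure_toMeasurable _).le

/-- Distinct points of a Poisson process almost surely avoid a given null set of tuples. -/
lemma IsPoissonPP.ae_notMem_of_null [TopologicalSpace E] [T2Space E] [SecondCountableTopology E]
    [OpensMeasurableSpace E] (h : IsPoissonPP P ξ μ) [SigmaFinite μ]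
    (hμ : μ univ = ⊤) {n : ℕ} {D : Set (Fin n → E)} (hD : Measure.pi (fun _ ↦ μ) D = 0) :
    ∀ᵐ ω ∂P, ∀ x : Fin n → E, Function.Injective x → (∀ i, x i ∈ ξ ω) → x ∉ D := by
  have hnull : ∀ (b : Fin n → TopologicalSpace.countableBasis E) (k : ℕ),
      Pairwise (Function.onFun Disjoint fun i ↦ (b i : Set E)) →
      ∀ᵐ ω ∂P, ¬ ∃ x ∈ D, ∀ i, x i ∈ ξ ω ∩ ((b i : Set E) ∩ spanningSets μ k) := by
    intro b k hb
    rw [ae_iff]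
    simp only [not_not]
    have hb' : Pairwise (Function.onFun Disjoint fun i ↦ (b i : Set E) ∩ spanningSets μ k) :=
      fun i j hij ↦ (hb hij).mono inter_subset_left inter_subset_left
    have hle := h.hittingOuterMeasure_le hμ (fun i ↦
      (TopologicalSpace.isOpen_of_mem_countableBasis (b i).2).measurableSet.inter
        (measurableSet_spanningSets μ k)) hb'
      (fun i ↦ measure_ne_top_of_subset inter_subset_right (measure_spanningSets_lt_top μ k).ne)
    refine le_antisymm ?_ zero_le
    obtain ⟨T, hDT, hT, hT0⟩ := exists_measurable_superset_of_null hD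
    rw [Measure.pi, toMeasure_apply _ _ hT] at hT0
    exact (((hittingOuterMeasure P ξ _).mono hDT).trans (hle T)).trans hT0.le
  have hall := ae_all_iff.2 fun b ↦ ae_all_iff.2 fun k ↦ ae_all_iff.2 fun hb ↦ hnull b k hb
  filter_upwards [hall] with ω hω x hinj hx hxD
  obtain ⟨U, hU, hUd⟩ := (Set.finite_range x).t2_separation
  have hb : ∀ i, ∃ v ∈ TopologicalSpace.countableBasis E, x i ∈ v ∧ v ⊆ U (x i) := fun i ↦
    (TopologicalSpace.isBasis_countableBasis E).exists_subset_of_mem_open (hU _).1 (hU _).2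
  choose b hbB hxb hbU using hb
  have hk : ∃ k, ∀ i, x i ∈ spanningSets μ k := by
    refine ⟨Finset.univ.sup fun i ↦ spanningSetsIndex μ (x i), fun i ↦ ?_⟩
    exact monotone_spanningSets μ (Finset.le_sup (f := fun i ↦ spanningSetsIndex μ (x i))
      (Finset.mem_univ i)) (mem_spanningSetsIndex μ (x i))
  obtain ⟨k, hk⟩ := hk
  refine hω (fun i ↦ ⟨b i, hbB i⟩) k (fun i j hij ↦ ?_)
    ⟨x, hxD, fun i ↦ ⟨hx i, hxb i, hk i⟩⟩
  exact (hUd (mem_range_self i) (mem_range_self j) (hinj.ne hij)).mono (hbU i) (hbU j)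

end Poisson

section GeneralPosition

variable {E : Type*} [NormedAddCommGroup E] [InnerProductSpace ℝ E]

/-- Pairs `(p, q)` such that `q` is affinely independent and `(p, ‖p‖²)` is an affine combination of
the points `(q i, ‖q i‖²)`; equivalently `p` lies in the affine span of `q` and on the
circumsphere of `q`. -/
def degeneratePairs (E : Type*) [NormedAddCommGroup E] [InnerProductSpace ℝ E] (n : ℕ) :
    Set (E × (Fin n → E)) :=
  {a | AffineIndependent ℝ a.2 ∧ ∃ w : Fin n → ℝ,
    ∑ i, w i = 1 ∧ ∑ i, w i • a.2 i = a.1 ∧ ∑ i, w i * ‖a.2 i‖ ^ 2 = ‖a.1‖ ^ 2}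

lemma measurableSet_degeneratePairs [FiniteDimensional ℝ E] [MeasurableSpace E] [BorelSpace E]
    (n : ℕ) : MeasurableSet (degeneratePairs E n) := by
  have : SecondCountableTopology E := secondCountable_of_proper
  have hopen : MeasurableSet {a : E × (Fin n → E) | AffineIndependent ℝ a.2} :=
    (isOpen_setOfPred_affineIndependent.preimage continuous_snd).measurableSet
  have hclosed (m : ℕ) : IsClosed {a : E × (Fin n → E) |
      ∃ w : Metric.closedBall (0 : Fin n → ℝ) m, ∑ i, w.1 i = 1 ∧
        ∑ i, w.1 i • a.2 i = a.1 ∧ ∑ i, w.1 i * ‖a.2 i‖ ^ 2 = ‖a.1‖ ^ 2} := by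
    have hC : IsClosed {b : Metric.closedBall (0 : Fin n → ℝ) m × (E × (Fin n → E)) |
        ∑ i, b.1.1 i = 1 ∧ ∑ i, b.1.1 i • b.2.2 i = b.2.1 ∧
          ∑ i, b.1.1 i * ‖b.2.2 i‖ ^ 2 = ‖b.2.1‖ ^ 2} := by
      have hw (i : Fin n) : Continuous fun b : Metric.closedBall (0 : Fin n → ℝ) m ×
          (E × (Fin n → E)) ↦ b.1.1 i :=
        (continuous_apply i).comp (continuous_subtype_val.comp continuous_fst)
      have hq (i : Fin n) : Continuous fun b : Metric.closedBall (0 : Fin n → ℝ) m ×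
          (E × (Fin n → E)) ↦ b.2.2 i :=
        (continuous_apply i).comp (continuous_snd.comp continuous_snd)
      have hp : Continuous fun b : Metric.closedBall (0 : Fin n → ℝ) m ×
          (E × (Fin n → E)) ↦ b.2.1 := continuous_fst.comp continuous_snd
      exact (isClosed_eq (continuous_finsetSum _ fun i _ ↦ hw i) continuous_const).inter
        ((isClosed_eq (continuous_finsetSum _ fun i _ ↦ (hw i).smul (hq i)) hp).inter
          (isClosed_eq (continuous_finsetSum _ fun i _ ↦ (hw i).mul ((hq i).norm.pow 2))
            (hp.norm.pow 2)))
    convert isClosedMap_snd_of_compactSpace _ hC using 1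
    ext a
    simp
  convert hopen.inter (MeasurableSet.iUnion fun m ↦ (hclosed m).measurableSet) using 1
  ext a
  simp only [degeneratePairs, mem_ofPred_eq, mem_inter_iff, mem_iUnion]
  refine and_congr_right fun _ ↦ ⟨fun ⟨w, hw⟩ ↦ ?_, fun ⟨m, w, hw⟩ ↦ ⟨w, hw⟩⟩
  obtain ⟨m, hm⟩ := exists_nat_ge ‖w‖
  exact ⟨m, ⟨w, by simpa using hm⟩, hw⟩

/-- A point whose lift to the paraboloid is an affine combination of the lifts of points on a
sphere lies on the same sphere. -/
lemma norm_sub_sq_eq_of_lift {ι : Type*} [Fintype ι] {q : ι → E} {w : ι → ℝ} {p c : E} {R : ℝ}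
    (hw : ∑ i, w i = 1) (hp : ∑ i, w i • q i = p) (hp2 : ∑ i, w i * ‖q i‖ ^ 2 = ‖p‖ ^ 2)
    (hq : ∀ i, ‖q i - c‖ ^ 2 = R) : ‖p - c‖ ^ 2 = R := by
  have h : ∑ i, w i * ‖q i - c‖ ^ 2 = ‖p - c‖ ^ 2 := by
    simp_rw [norm_sub_sq_real, mul_add, mul_sub, Finset.sum_add_distrib, Finset.sum_sub_distrib,
      hp2, ← hp, sum_inner, inner_smul_left, ← Finset.sum_mul, hw, Finset.mul_sum]
    simp [mul_left_comm]
  rw [← h]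
  simp_rw [hq, ← Finset.sum_mul, hw, one_mul]

/-- A point on a sphere that is an affine combination of points of that sphere satisfies the same
relation after lifting to the paraboloid. -/
lemma sum_mul_norm_sq_eq_of_norm_sub_sq {ι : Type*} [Fintype ι] {q : ι → E} {w : ι → ℝ} {p c : E}
    {R : ℝ} (hw : ∑ i, w i = 1) (hp : ∑ i, w i • q i = p)
    (hpc : ‖p - c‖ ^ 2 = R) (hq : ∀ i, ‖q i - c‖ ^ 2 = R) :
    ∑ i, w i * ‖q i‖ ^ 2 = ‖p‖ ^ 2 := by
  have h : ∑ i, w i * ‖q i - c‖ ^ 2 = ∑ i, w i * ‖q i‖ ^ 2 - 2 * inner ℝ p c + ‖c‖ ^ 2 := by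
    simp_rw [norm_sub_sq_real, mul_add, mul_sub, Finset.sum_add_distrib, Finset.sum_sub_distrib,
      ← hp, sum_inner, inner_smul_left, ← Finset.sum_mul, hw, Finset.mul_sum]
    simp [mul_left_comm]
  simp_rw [hq, ← Finset.sum_mul, hw, one_mul] at h
  rw [norm_sub_sq_real] at hpc
  linarith

lemma measure_degeneratePairs [FiniteDimensional ℝ E] [MeasurableSpace E] [BorelSpace E]
    [Nontrivial E] (μ : Measure E) [μ.IsAddHaarMeasure] (n : ℕ) :
    (μ.prod (Measure.pi fun _ : Fin n ↦ μ)) (degeneratePairs E n) = 0 := by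
  rw [Measure.prod_apply_symm (measurableSet_degeneratePairs n)]
  refine lintegral_eq_zero_of_ae_eq_zero (Eventually.of_forall fun q ↦ ?_)
  by_cases hq : AffineIndependent ℝ q
  · rcases n with _ | n
    · refine (congrArg μ (eq_empty_of_forall_notMem fun p hp ↦ ?_)).trans measure_empty
      simp [degeneratePairs] at hp
    · let s : Affine.Simplex ℝ E n := ⟨q, hq⟩
      refine measure_mono_null ?_ (Measure.addHaar_sphere μ s.circumcenter s.circumradius)
      rintro p ⟨-, w, hw, hp, hp2⟩
      have hc : ∀ i, ‖q i - s.circumcenter‖ ^ 2 = s.circumradius ^ 2 := fun i ↦ by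
        rw [← dist_eq_norm]
        exact congrArg (· ^ 2) (s.dist_circumcenter_eq_circumradius i)
      have := norm_sub_sq_eq_of_lift hw hp hp2 hc
      rw [mem_sphere_iff_norm]
      exact (sq_eq_sq₀ (norm_nonneg _) s.circumradius_nonneg).1 this
  · exact (congrArg μ (eq_empty_of_forall_notMem fun p hp ↦ hq hp.1)).trans measure_empty

/-- Every set of points of `X` lying on a common sphere is affinely independent. -/
def SphericallyGeneric (X : Set E) : Prop :=
  ∀ (z : E) (R : ℝ), AffineIndependent ℝ ((↑) : {p ∈ X | dist z p = R} → E)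

lemma SphericallyGeneric.of_notMem_degeneratePairs [FiniteDimensional ℝ E] {X : Set E}
    (h : ∀ (n : ℕ) (x : Fin (n + 1) → E), Function.Injective x → (∀ i, x i ∈ X) →
      (x 0, fun i : Fin n ↦ x i.succ) ∉ degeneratePairs E n) : SphericallyGeneric X := by
  intro z R
  obtain ⟨t, hts, hspan, ht⟩ := exists_affineIndependent ℝ E {p ∈ X | dist z p = R}
  suffices t = {p ∈ X | dist z p = R} by rwa [← this]
  refine hts.antisymm fun p hp ↦ by_contra fun hpt ↦ ?_
  have : Finite t := finite_set_of_fin_dim_affineIndependent ℝ ht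
  obtain ⟨n, ⟨e⟩⟩ := Finite.exists_equiv_fin t
  let q : Fin n → E := fun i ↦ (e.symm i : E)
  have hq : AffineIndependent ℝ q := ht.comp_embedding e.symm.toEmbedding
  have hrange : range q = t := by
    ext a
    refine ⟨?_, fun ha ↦ ⟨e ⟨a, ha⟩, by simp [q]⟩⟩
    rintro ⟨i, rfl⟩
    exact (e.symm i).2
  have hpq : p ∈ affineSpan ℝ (range q) := by
    rw [hrange, hspan]
    exact subset_affineSpan ℝ _ hp
  obtain ⟨w, hw, hpw⟩ := eq_affineCombination_of_mem_affineSpan_of_fintype hpq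
  rw [Finset.affineCombination_eq_linear_combination _ _ _ hw] at hpw
  have hsph : ∀ a ∈ {p ∈ X | dist z p = R}, ‖a - z‖ ^ 2 = R ^ 2 := fun a ha ↦ by
    rw [← ha.2, dist_eq_norm, norm_sub_rev]
  have hqt : ∀ i, q i ∈ {p ∈ X | dist z p = R} := fun i ↦ hts (e.symm i).2
  refine h n (Fin.cons p q) (Fin.cons_injective_iff.2 ⟨by rwa [hrange], hq.injective⟩)
    (fun i ↦ ?_) ?_
  · refine Fin.cases ?_ (fun i ↦ ?_) i
    · exact hp.1
    · exact (hqt i).1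
  · have hlift := sum_mul_norm_sq_eq_of_norm_sub_sq hw hpw.symm (hsph p hp) fun i ↦ hsph _ (hqt i)
    exact ⟨by simpa using hq, w, hw, by simpa using hpw.symm, by simpa using hlift⟩

lemma IsPoissonPP.ae_sphericallyGeneric [FiniteDimensional ℝ E] [MeasurableSpace E] [BorelSpace E]
    [Nontrivial E] {Ω : Type*} [MeasurableSpace Ω] {P : Measure Ω} {ξ : Ω → Set E}
    {μ : Measure E} [μ.IsAddHaarMeasure] (h : IsPoissonPP P ξ μ) :
    ∀ᵐ ω ∂P, SphericallyGeneric (ξ ω) := by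
  have : SecondCountableTopology E := secondCountable_of_proper
  have : NoncompactSpace E := NormedSpace.noncompactSpace ℝ E
  have hall : ∀ᵐ ω ∂P, ∀ n : ℕ, ∀ x : Fin (n + 1) → E, Function.Injective x →
      (∀ i, x i ∈ ξ ω) →
        x ∉ MeasurableEquiv.piFinSuccAbove (fun _ ↦ E) 0 ⁻¹' degeneratePairs E n := by
    refine ae_all_iff.2 fun n ↦ h.ae_notMem_of_null (measure_univ_of_isAddLeftInvariant μ) ?_
    rw [(measurePreserving_piFinSuccAbove (fun _ ↦ μ) 0).measure_preimage_equiv]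
    exact measure_degeneratePairs μ n
  filter_upwards [hall] with ω hω
  exact SphericallyGeneric.of_notMem_degeneratePairs fun n x hx hxX ↦ hω n x hx hxX

end GeneralPosition

section Robust

lemma isClosed_of_finite_inter_ball {E : Type*} [NormedAddCommGroup E] {X : Set E}
    (hX : ∀ n : ℕ, (X ∩ Metric.ball 0 n).Finite) :
    IsClosed X := by
  rw [← isOpen_compl_iff, isOpen_iff_mem_nhds]
  intro a ha
  obtain ⟨n, hn⟩ := exists_nat_gt ‖a‖
  filter_upwards [(hX n).isClosed.isOpen_compl.mem_nhds fun h ↦ ha h.1,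
    Metric.isOpen_ball.mem_nhds (mem_ball_zero_iff.2 hn)] with b hb hb' hbX
  exact hb ⟨hbX, hb'⟩

lemma exists_forall_add_le_max_of_disjoint_vorCell {E : Type*} [MetricSpace E] {X : Set E}
    {x y : E} (h : vorCell x X ∩ vorCell y X = ∅) {K : Set E} (hK : IsCompact K) :
    ∃ δ > 0, ∀ w ∈ K, Metric.infDist w X + δ ≤ max (dist w x) (dist w y) := by
  rcases K.eq_empty_or_nonempty with rfl | hne
  · exact ⟨1, one_pos, by simp⟩
  have hcont : Continuous fun w ↦ max (dist w x) (dist w y) - Metric.infDist w X :=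
    ((continuous_id.dist continuous_const).max (continuous_id.dist continuous_const)).sub
      (Metric.continuous_infDist_pt X)
  obtain ⟨w, -, hw⟩ := hK.exists_isMinOn hne hcont.continuousOn
  refine ⟨max (dist w x) (dist w y) - Metric.infDist w X, ?_, fun u hu ↦ ?_⟩
  · by_contra! hle
    have hmem : w ∈ vorCell x X ∩ vorCell y X :=
      ⟨(le_max_left _ _).trans (sub_nonpos.1 hle), (le_max_right _ _).trans (sub_nonpos.1 hle)⟩
    simp [h] at hmem
  · exact add_le_of_le_sub_left (hw hu)

variable {E : Type*} [NormedAddCommGroup E] [InnerProductSpace ℝ E] [FiniteDimensional ℝ E]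

/-- For two points `x`, `y` of an affinely independent set, there is a direction `v` orthogonal to
`x - y` moving away from all the other points of the set faster than from `x`. -/
lemma AffineIndependent.exists_inner_sub_eq {S : Set E}
    (hS : AffineIndependent ℝ ((↑) : S → E)) {x y : E} (hx : x ∈ S) (hy : y ∈ S) :
    ∃ v : E, inner ℝ v (x - y) = 0 ∧ ∀ p ∈ S, p ≠ x → p ≠ y → 0 < inner ℝ v (x - p) := by
  classical
  obtain ⟨t, hSt, ht, hspan⟩ := exists_subset_affineIndependent_affineSpan_eq_top hS
  let b : AffineBasis t ℝ E := ⟨(↑), ht, by simpa using hspan⟩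
  let i : t := ⟨x, hSt hx⟩
  let j : t := ⟨y, hSt hy⟩
  let f : E →ᵃ[ℝ] ℝ := b.coord i + b.coord j
  have hf : ∀ p ∈ S, f p = (if x = p then 1 else 0) + if y = p then 1 else 0 := fun p hp ↦ by
    have h1 : b.coord i p = _ := b.coord_apply i ⟨p, hSt hp⟩
    have h2 : b.coord j p = _ := b.coord_apply j ⟨p, hSt hp⟩
    simp only [i, j, Subtype.mk.injEq] at h1 h2
    rw [← h1, ← h2]
    rfl
  let g : E →L[ℝ] ℝ := LinearMap.toContinuousLinearMap f.linear
  have hg : ∀ p, inner ℝ ((InnerProductSpace.toDual ℝ E).symm g) (x - p) = f x - f p := fun p ↦ by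
    rw [InnerProductSpace.toDual_symm_apply]
    exact f.linearMap_vsub x p
  refine ⟨(InnerProductSpace.toDual ℝ E).symm g, ?_, fun p hp hpx hpy ↦ ?_⟩
  · rw [hg, hf x hx, hf y hy]
    simp [eq_comm (a := y), add_comm]
  · rw [hg, hf x hx, hf p hp]
    simp only [if_true, hpx.symm, hpy.symm, if_false]
    split_ifs <;> norm_num

/-- In a spherically generic, locally finite configuration, any point shared by two Voronoi cells
can be approximated by points of the relative interior of their common face. -/
lemma exists_witness {X : Set E} (hfin : ∀ n : ℕ, (X ∩ Metric.ball 0 n).Finite)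
    (hgen : SphericallyGeneric X) {x y z : E} (hx : x ∈ X) (hy : y ∈ X)
    (hne : (X \ {x, y}).Nonempty)
    (hzx : z ∈ vorCell x X) (hzy : z ∈ vorCell y X) {U : Set E} (hU : U ∈ 𝓝 z) :
    ∃ w ∈ U, dist w x = dist w y ∧ dist w y < Metric.infDist w (X \ {x, y}) := by
  have hle : ∀ p ∈ X, dist z x ≤ dist z p := fun p hp ↦ hzx.trans (Metric.infDist_le_dist_of_mem hp)
  have hxy : dist z y = dist z x := le_antisymm (hzy.trans (Metric.infDist_le_dist_of_mem hx))
    (hle y hy)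
  obtain ⟨v, hv0, hv⟩ := (hgen z (dist z x)).exists_inner_sub_eq (x := x) (y := y)
    ⟨hx, rfl⟩ ⟨hy, hxy⟩
  have hlim : Tendsto (fun t : ℝ ↦ z + t • v) (𝓝[>] 0) (𝓝 z) := by
    have : Continuous fun t : ℝ ↦ z + t • v := by fun_prop
    simpa using (this.tendsto 0).mono_left nhdsWithin_le_nhds
  have hdist : ∀ (t : ℝ) (p : E), dist (z + t • v) p ^ 2 - dist (z + t • v) x ^ 2 =
      dist z p ^ 2 - dist z x ^ 2 + 2 * t * inner ℝ v (x - p) := by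
    intro t p
    have hexp : ∀ a, dist (z + t • v) a ^ 2 =
        dist z a ^ 2 + 2 * (t * (inner ℝ v z - inner ℝ v a)) + ‖t • v‖ ^ 2 := fun a ↦ by
      rw [dist_eq_norm, dist_eq_norm, add_sub_right_comm, norm_add_sq_real, real_inner_smul_right,
        real_inner_comm, inner_sub_right]
    rw [hexp, hexp, inner_sub_right]
    ring
  have hclose : ∀ p ∈ X, p ≠ x → p ≠ y →
      ∀ᶠ t in 𝓝[>] (0 : ℝ), dist (z + t • v) x < dist (z + t • v) p := by
    intro p hp hpx hpy
    rcases (hle p hp).eq_or_lt with heq | hlt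
    · filter_upwards [self_mem_nhdsWithin] with t ht
      have h1 := hdist t p
      have h2 : 0 < 2 * t * inner ℝ v (x - p) :=
        mul_pos (mul_pos two_pos ht) (hv p ⟨hp, heq.symm⟩ hpx hpy)
      rw [heq, sub_self, zero_add] at h1
      exact lt_of_pow_lt_pow_left₀ 2 dist_nonneg (by linarith)
    · exact (hlim.dist tendsto_const_nhds).eventually_lt (hlim.dist tendsto_const_nhds) hlt
  obtain ⟨N, hN⟩ := exists_nat_gt (‖z‖ + dist z x + 3)
  have hnear : ∀ᶠ t in 𝓝[>] (0 : ℝ), ∀ p ∈ X ∩ Metric.ball 0 N, p ≠ x → p ≠ y →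
      dist (z + t • v) x < dist (z + t • v) p := by
    rw [eventually_all_finite (hfin N)]
    intro p hp
    by_cases hpx : p = x
    · simp [hpx]
    by_cases hpy : p = y
    · simp [hpy]
    filter_upwards [hclose p hp.1 hpx hpy] with t ht _ _ using ht
  obtain ⟨t, htU, ht1, htn⟩ := ((hlim.eventually hU).and
    ((hlim.eventually (Metric.ball_mem_nhds z one_pos)).and hnear)).exists
  set w := z + t • v with hw
  have hwxy : dist w x = dist w y := by
    have := hdist t y
    rw [hv0, hxy, ← hw] at this
    exact (sq_eq_sq₀ dist_nonneg dist_nonneg).1 (by linarith)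
  refine ⟨w, htU, hwxy, ?_⟩
  have hclosed : IsClosed (X \ {x, y}) := isClosed_of_finite_inter_ball fun n ↦
    (hfin n).subset (inter_subset_inter_left _ sdiff_subset)
  obtain ⟨p, ⟨hpX, hpxy⟩, hp⟩ := hclosed.exists_infDist_eq_dist hne w
  simp only [mem_insert_iff, mem_singleton_iff, not_or] at hpxy
  rw [hp, ← hwxy]
  by_cases hpN : p ∈ Metric.ball (0 : E) N
  · exact htn p ⟨hpX, hpN⟩ hpxy.1 hpxy.2
  · rw [mem_ball_zero_iff, not_lt] at hpN
    have h1 : dist w z < 1 := ht1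
    have h2 := dist_triangle w z x
    have h3 := dist_triangle_left z p w
    have h4 : ‖p‖ ≤ ‖z‖ + dist z p := by
      rw [dist_eq_norm]
      exact norm_le_norm_add_norm_sub _ _
    linarith

lemma exists_isRobust {d : ℕ} {X : Set (EuclideanSpace ℝ (Fin d))}
    (hfin : ∀ n : ℕ, (X ∩ Metric.ball 0 n).Finite) (hgen : SphericallyGeneric X)
    (hunb : ∀ n : ℕ, ∃ p ∈ X, p ∉ Metric.ball 0 n) (r : ℝ) :
    ∃ ρ ∈ Ioo (0 : ℝ) 1, IsRobust X r ρ := by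
  have hfinr : (X ∩ Metric.ball 0 r).Finite := by
    obtain ⟨n, hn⟩ := exists_nat_ge r
    exact (hfin n).subset (inter_subset_inter_right _ (Metric.ball_subset_ball hn))
  have hne : ∀ x y, (X \ {x, y}).Nonempty := fun x y ↦ by
    obtain ⟨n, hn⟩ := exists_nat_gt (max ‖x‖ ‖y‖)
    obtain ⟨p, hp, hpn⟩ := hunb n
    refine ⟨p, hp, ?_⟩
    rintro (rfl | rfl)
    · exact hpn (mem_ball_zero_iff.2 ((le_max_left _ _).trans_lt hn))
    · exact hpn (mem_ball_zero_iff.2 ((le_max_right _ _).trans_lt hn))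
  have hlim : Tendsto (fun ρ : ℝ ↦ ρ * r) (𝓝[>] 0) (𝓝 0) := by
    simpa using (continuous_mul_const r).tendsto 0 |>.mono_left nhdsWithin_le_nhds
  have hrob : ∀ᶠ ρ in 𝓝[>] (0 : ℝ), IsRobust X r ρ := by
    refine (eventually_all_finite hfinr).2 fun x hx ↦ (eventually_all_finite hfinr).2 fun y hy ↦ ?_
    refine eventually_all.2 fun _ ↦ Eventually.and ?_ ?_
    · refine eventually_all.2 fun ⟨z, hz, hzx, hzy⟩ ↦ ?_
      obtain ⟨w, hw, hwxy, hlt⟩ := exists_witness hfin hgen hx.1 hy.1 (hne x y) hzx hzy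
        (Metric.isOpen_ball.mem_nhds hz)
      filter_upwards [hlim.eventually (gt_mem_nhds (sub_pos.2 hlt))] with ρ hρ
      exact ⟨w, hw, hwxy, by linarith⟩
    · refine eventually_all.2 fun hempty ↦ ?_
      obtain ⟨δ, hδ, hle⟩ := exists_forall_add_le_max_of_disjoint_vorCell hempty
        (isCompact_closedBall 0 (2 * r))
      filter_upwards [hlim.eventually (gt_mem_nhds hδ)] with ρ hρ w hw
      have := hle w (Metric.ball_subset_closedBall hw)
      linarith
  have hIoo : ∀ᶠ ρ in 𝓝[>] (0 : ℝ), ρ ∈ Ioo (0 : ℝ) 1 := Ioo_mem_nhdsGT one_pos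
  exact (hIoo.and hrob).exists

end Robust

/-- For every `r > 0`, a homogeneous Poisson point process on `ℝ^d` is almost surely
`(r,ρ)`-robust for some `ρ ∈ (0,1)`. -/
theorem stmt11 (d : ℕ) (hd : 1 ≤ d)
    {Ω : Type*} [MeasurableSpace Ω] (P : Measure Ω) [IsProbabilityMeasure P]
    (ξ : Ω → Set (EuclideanSpace ℝ (Fin d)))
    (hξ : IsPoissonPP P ξ volume)
    (r : ℝ) (hr : 0 < r) :
    P {ω | ∃ ρ ∈ Set.Ioo (0 : ℝ) 1, IsRobust (ξ ω) r ρ} = 1 := by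
  have : NeZero d := ⟨by omega⟩
  have : Nonempty (Fin d) := ⟨0⟩
  have hμ : (volume : Measure (EuclideanSpace ℝ (Fin d))) univ = ⊤ :=
    have : NoncompactSpace (EuclideanSpace ℝ (Fin d)) := NormedSpace.noncompactSpace ℝ _
    measure_univ_of_isAddLeftInvariant volume
  have hfin : ∀ᵐ ω ∂P, ∀ n : ℕ, (ξ ω ∩ Metric.ball 0 n).Finite := ae_all_iff.2 fun n ↦
    hξ.ae_finite_inter measurableSet_ball measure_ball_lt_top.ne hμ
  have hunb : ∀ᵐ ω ∂P, ∀ n : ℕ, ∃ p ∈ ξ ω, p ∉ Metric.ball 0 n := ae_all_iff.2 fun n ↦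
    hξ.ae_exists_notMem hμ measurableSet_ball measure_ball_lt_top.ne
  have hall : ∀ᵐ ω ∂P, ∃ ρ ∈ Ioo (0 : ℝ) 1, IsRobust (ξ ω) r ρ := by
    filter_upwards [hfin, hunb, hξ.ae_sphericallyGeneric] with ω h1 h2 h3
    exact exists_isRobust h1 h3 h2 r
  rw [measure_congr (eventuallyEq_univ.2 hall), measure_univ]
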